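/- arXiv:2502.13235 — 16 statements merged into one kernel-verified Lean document; each statement's English description precedes it below -/
import Mathlib

section
/- An A-structure S is a positive A-structure (i.e. x ≥ 0 for all x ∈ S) if and only if the inequality v ⩖ u ≤ u + v holds for all u, v ∈ S. -/
/-- A commutative monoid equipped with two partial orders (the initial order `le` = `≤`
and the specific order `sle` = `⪯`), each compatible with addition. -/
structure TwoOrders (M : Type*) [AddCommMonoid M] where
  le : M → M → Prop
  sle : M → M → Prop
  le_refl : ∀ x, le x x
  le_antisymm : ∀ x y, le x y → le y x → x = y
  le_trans : ∀ x y z, le x y → le y z → le x z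
  sle_refl : ∀ x, sle x x
  sle_antisymm : ∀ x y, sle x y → sle y x → x = y
  sle_trans : ∀ x y z, sle x y → sle y z → sle x z
  add_le_add : ∀ x y w, le x y → le (x + w) (y + w)
  add_sle_add : ∀ x y w, sle x y → sle (x + w) (y + w)

/-- `w` is the mixed upper envelope `u ⩖ v`, i.e. the least element (w.r.t. `le`) of
`{w : sle u w ∧ le v w}`. -/
def TwoOrders.IsUpperEnv {M : Type*} [AddCommMonoid M] (O : TwoOrders M) (u v w : M) : Prop :=
  O.sle u w ∧ O.le v w ∧ ∀ z, O.sle u z → O.le v z → O.le w z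

/-- `w` is the mixed lower envelope `u ⩗ v`, i.e. the greatest element (w.r.t. `le`) of
`{w : sle w u ∧ le w v}`. -/
def TwoOrders.IsLowerEnv {M : Type*} [AddCommMonoid M] (O : TwoOrders M) (u v w : M) : Prop :=
  O.sle w u ∧ O.le w v ∧ ∀ z, O.sle z u → O.le z v → O.le z w

/-- An A-structure: naturally ordered w.r.t. `sle`, strong cancellation for `le`,
and all mixed upper envelopes exist. -/
def TwoOrders.IsAStructure {M : Type*} [AddCommMonoid M] (O : TwoOrders M) : Prop :=
  (∀ u v, O.sle u v ↔ ∃ w, v = u + w) ∧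
  (∀ u v w, O.le u v ↔ O.le (u + w) (v + w)) ∧
  (∀ u v, ∃ w, O.IsUpperEnv u v w)

/-- A B-structure: naturally ordered w.r.t. `le`, strong cancellation for `sle`,
and all mixed upper envelopes exist. -/
def TwoOrders.IsBStructure {M : Type*} [AddCommMonoid M] (O : TwoOrders M) : Prop :=
  (∀ u v, O.le u v ↔ ∃ w, v = u + w) ∧
  (∀ u v w, O.sle u v ↔ O.sle (u + w) (v + w)) ∧
  (∀ u v, ∃ w, O.IsUpperEnv u v w)

/-- A mixed lattice group: all mixed upper and lower envelopes exist. -/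
def TwoOrders.IsMLG {M : Type*} [AddCommMonoid M] (O : TwoOrders M) : Prop :=
  (∀ u v, ∃ w, O.IsUpperEnv u v w) ∧ (∀ u v, ∃ w, O.IsLowerEnv u v w)

theorem positive_Astructure_iff {M : Type*} [AddCommMonoid M]
    (O : TwoOrders M) (hA : O.IsAStructure) :
    (∀ x : M, O.le 0 x) ↔ (∀ u v w : M, O.IsUpperEnv v u w → O.le w (u + v)) := by
  constructor
  · intro hpos u v w hw
    refine hw.2.2 _ ((hA.1 _ _).2 ⟨u, add_comm u v⟩) ?_
    simpa [add_comm] using O.add_le_add 0 v u (hpos v)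
  · intro h x
    obtain ⟨w, hw⟩ := hA.2.2 x 0
    exact O.le_trans _ _ _ hw.2.1 (by simpa using h 0 x w hw)
end

section
/- If S is a weak mixed lattice semigroup, then the inequality v ⩖ u + u ⩗ v ≤ u + v holds for all u, v ∈ S. -/
theorem weak_mls_envelope_ineq {M : Type*} [AddCommMonoid M]
    (O : TwoOrders M) (hA : O.IsAStructure)
    (hW : ∀ u v : M, ∃ w, O.IsLowerEnv u v w) :
    ∀ u v a b : M, O.IsUpperEnv v u a → O.IsLowerEnv u v b → O.le (a + b) (u + v) := by
  rintro u v a b ⟨-, -, ha⟩ ⟨hbu, hbv, -⟩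
  obtain ⟨c, rfl⟩ := (hA.1 b u).1 hbu
  have hac : O.le a (v + c) :=
    ha (v + c) ((hA.1 v (v + c)).2 ⟨c, rfl⟩) (O.add_le_add b v c hbv)
  have heq : b + c + v = v + c + b := by abel
  rw [heq]
  exact O.add_le_add a (v + c) b hac
end

section
/- Let S be a positive A-structure. Then S is a weak mixed lattice semigroup if and only if for all u, v ∈ S the set {w ∈ S : v ⩖ u + w ≤ u + v and w ⪯ u} has a greatest element M with respect to ≤; moreover, in that case M = u ⩗ v. -/
/-- Below `u` in the specific order, the elements `z` with `(v ⩖ u) + z ≤ u + v` are exactly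
those with `z ≤ v`. -/
theorem TwoOrders.IsAStructure.upperEnv_add_le_iff {M : Type*} [AddCommMonoid M]
    {O : TwoOrders M} (hA : O.IsAStructure) {u v e z : M} (he : O.IsUpperEnv v u e)
    (hz : O.sle z u) : O.le (e + z) (u + v) ↔ O.le z v := by
  obtain ⟨hnat, hcancel, -⟩ := hA
  obtain ⟨-, hue, hleast⟩ := he
  constructor
  · intro h
    rw [hcancel z v u, add_comm z u, add_comm v u]
    exact O.le_trans _ _ _ (O.add_le_add _ _ z hue) h
  · intro h
    obtain ⟨a, rfl⟩ := (hnat z u).1 hz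
    have hle : O.le e (v + a) :=
      hleast _ ((hnat _ _).2 ⟨a, rfl⟩) (O.add_le_add _ _ a h)
    have heq : z + a + v = v + a + z := by abel
    rw [heq]
    exact O.add_le_add _ _ z hle

/-- The greatest element of `{z : (v ⩖ u) + z ≤ u + v ∧ z ⪯ u}` is the mixed lower envelope
`u ⩗ v`. -/
theorem TwoOrders.IsAStructure.greatest_iff_isLowerEnv {M : Type*} [AddCommMonoid M]
    {O : TwoOrders M} (hA : O.IsAStructure) {u v e m : M} (he : O.IsUpperEnv v u e) :
    ((O.le (e + m) (u + v) ∧ O.sle m u) ∧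
      ∀ z, (O.le (e + z) (u + v) ∧ O.sle z u) → O.le z m) ↔ O.IsLowerEnv u v m := by
  constructor
  · rintro ⟨⟨hm, hmu⟩, hmax⟩
    exact ⟨hmu, (hA.upperEnv_add_le_iff he hmu).1 hm,
      fun z hzu hzv => hmax z ⟨(hA.upperEnv_add_le_iff he hzu).2 hzv, hzu⟩⟩
  · rintro ⟨hmu, hmv, hmax⟩
    exact ⟨⟨(hA.upperEnv_add_le_iff he hmu).2 hmv, hmu⟩,
      fun z hz => hmax z hz.2 ((hA.upperEnv_add_le_iff he hz.2).1 hz.1)⟩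

theorem weak_mls_characterization {M : Type*} [AddCommMonoid M]
    (O : TwoOrders M) (hA : O.IsAStructure) (hpos : ∀ x : M, O.le 0 x) :
    ((∀ u v : M, ∃ w, O.IsLowerEnv u v w) ↔
      (∀ u v e : M, O.IsUpperEnv v u e →
        ∃ m, (O.le (e + m) (u + v) ∧ O.sle m u) ∧
          ∀ z, (O.le (e + z) (u + v) ∧ O.sle z u) → O.le z m)) ∧
    (∀ u v e m : M, O.IsUpperEnv v u e →
      ((O.le (e + m) (u + v) ∧ O.sle m u) ∧
        ∀ z, (O.le (e + z) (u + v) ∧ O.sle z u) → O.le z m) →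
      O.IsLowerEnv u v m) := by
  refine ⟨⟨fun h u v e he => ?_, fun h u v => ?_⟩,
    fun u v e m he => (hA.greatest_iff_isLowerEnv he).1⟩
  · obtain ⟨m, hm⟩ := h u v
    exact ⟨m, (hA.greatest_iff_isLowerEnv he).2 hm⟩
  · obtain ⟨e, he⟩ := hA.2.2 v u
    obtain ⟨m, hm⟩ := h u v e he
    exact ⟨m, (hA.greatest_iff_isLowerEnv he).1 hm⟩
end

section
/- Every weak mixed lattice semigroup is a positive A-structure; that is, if S is a weak mixed lattice semigroup then x ≥ 0 for all x ∈ S. -/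
theorem weak_mls_is_positive {M : Type*} [AddCommMonoid M]
    (O : TwoOrders M) (hA : O.IsAStructure)
    (hW : ∀ u v : M, ∃ w, O.IsLowerEnv u v w) :
    ∀ x : M, O.le 0 x := by
  intro x
  obtain ⟨w, hw0, hwx, -⟩ := hW 0 x
  have h : w = 0 := O.sle_antisymm w 0 hw0 ((hA.1 0 w).2 ⟨w, (zero_add w).symm⟩)
  exact h ▸ hwx
end

section
/- An A-structure S is a mixed lattice semigroup if and only if the inequality v ⩖ u ⪯ u + v holds for all u, v ∈ S. -/
namespace TwoOrders

variable {M : Type*} [AddCommMonoid M] {O : TwoOrders M}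

theorem IsAStructure.sle_add_right (hA : O.IsAStructure) (x y : M) : O.sle x (x + y) :=
  (hA.1 _ _).2 ⟨y, rfl⟩

theorem IsAStructure.add_left_cancel (hA : O.IsAStructure) {x y w : M} (h : w + x = w + y) :
    x = y := by
  rw [add_comm w x, add_comm w y] at h
  exact O.le_antisymm _ _ ((hA.2.1 x y w).2 (h ▸ O.le_refl _))
    ((hA.2.1 y x w).2 (h ▸ O.le_refl _))

theorem IsLowerEnv.unique {u v a b : M} (ha : O.IsLowerEnv u v a) (hb : O.IsLowerEnv u v b) :
    a = b :=
  O.le_antisymm _ _ (hb.2.2 a ha.1 ha.2.1) (ha.2.2 b hb.1 hb.2.1)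

/-- A complement of the upper envelope `v ⩖ u` in `u + v` is the lower envelope `u ⩗ v`. -/
theorem IsAStructure.isLowerEnv_of_add_eq (hA : O.IsAStructure) {u v a b : M}
    (ha : O.IsUpperEnv v u a) (h : u + v = a + b) : O.IsLowerEnv u v b := by
  obtain ⟨hva, hua, hmin⟩ := ha
  refine ⟨?_, ?_, fun z hzu hzv => ?_⟩
  · obtain ⟨c, rfl⟩ := (hA.1 _ _).1 hva
    have hu : u = b + c := hA.add_left_cancel (w := v) (by rw [add_comm v u, h]; abel)
    exact hu ▸ hA.sle_add_right b c
  · have hub := O.add_le_add _ _ b hua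
    rw [← h, add_comm u b, add_comm u v] at hub
    exact (hA.2.1 _ _ _).2 hub
  · obtain ⟨d, rfl⟩ := (hA.1 _ _).1 hzu
    have had := O.add_le_add _ _ z (hmin (v + d) (hA.sle_add_right v d) (O.add_le_add _ _ d hzv))
    rw [show v + d + z = z + d + v by abel, h, add_comm a z, add_comm a b] at had
    exact (hA.2.1 _ _ _).2 had

end TwoOrders

theorem mls_iff_sle_ineq {M : Type*} [AddCommMonoid M]
    (O : TwoOrders M) (hA : O.IsAStructure) :
    ((∀ u v : M, ∃ w, O.IsLowerEnv u v w) ∧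
      (∀ u v a b : M, O.IsUpperEnv u v a → O.IsLowerEnv v u b → a + b = u + v)) ↔
    (∀ u v w : M, O.IsUpperEnv v u w → O.sle w (u + v)) := by
  constructor
  · rintro ⟨hlow, hadd⟩ u v w hw
    obtain ⟨b, hb⟩ := hlow u v
    rw [add_comm u v, ← hadd v u w b hw hb]
    exact hA.sle_add_right w b
  · intro h
    refine ⟨fun u v => ?_, fun u v a b ha hb => ?_⟩
    · obtain ⟨a, ha⟩ := hA.2.2 v u
      obtain ⟨b, hb⟩ := (hA.1 _ _).1 (h u v a ha)
      exact ⟨b, hA.isLowerEnv_of_add_eq ha hb⟩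
    · obtain ⟨c, hc⟩ := (hA.1 _ _).1 (h v u a ha)
      rw [hb.unique (hA.isLowerEnv_of_add_eq ha hc), ← hc, add_comm]
end

section
/- An A-structure S is a mixed lattice semigroup if and only if the mixed lower envelope u ⩗ v exists for all u, v ∈ S and the translation invariance (u + a) ⩗ (v + a) = (u ⩗ v) + a holds for all u, v, a ∈ S. -/
/-- Strong cancellation for `le` makes the monoid cancellative. -/
theorem TwoOrders.IsAStructure.add_right_cancel {M : Type*} [AddCommMonoid M] {O : TwoOrders M}
    (hA : O.IsAStructure) {u v w : M} (h : u + w = v + w) : u = v :=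
  O.le_antisymm _ _ ((hA.2.1 u v w).2 (h ▸ O.le_refl _)) ((hA.2.1 v u w).2 (h ▸ O.le_refl _))

/-- Mixed upper envelopes in an A-structure are translation invariant. -/
theorem TwoOrders.IsAStructure.isUpperEnv_add {M : Type*} [AddCommMonoid M] {O : TwoOrders M}
    (hA : O.IsAStructure) {u v w : M} (h : O.IsUpperEnv u v w) (a : M) :
    O.IsUpperEnv (u + a) (v + a) (w + a) := by
  refine ⟨O.add_sle_add _ _ _ h.1, O.add_le_add _ _ _ h.2.1, fun z hz hvz => ?_⟩
  obtain ⟨t, rfl⟩ := (hA.1 _ _).1 hz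
  rw [add_right_comm] at hvz ⊢
  exact O.add_le_add _ _ _ (h.2.2 _ ((hA.1 _ _).2 ⟨t, rfl⟩) ((hA.2.1 _ _ _).2 hvz))

theorem mls_iff_translation_invariance {M : Type*} [AddCommMonoid M]
    (O : TwoOrders M) (hA : O.IsAStructure) :
    ((∀ u v : M, ∃ w, O.IsLowerEnv u v w) ∧
      (∀ u v a b : M, O.IsUpperEnv u v a → O.IsLowerEnv v u b → a + b = u + v)) ↔
    ((∀ u v : M, ∃ w, O.IsLowerEnv u v w) ∧
      (∀ u v a w : M, O.IsLowerEnv u v w → O.IsLowerEnv (u + a) (v + a) (w + a))) := by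
  refine and_congr_right fun hex => ⟨fun hsum u v a w hw => ?_, fun htrans u v a b ha hb => ?_⟩
  · obtain ⟨p, hp⟩ := hA.2.2 v u
    obtain ⟨c, hc⟩ := hex (u + a) (v + a)
    have h₁ := hsum _ _ _ _ hp hw
    have h₂ := hsum _ _ _ _ (hA.isUpperEnv_add hp a) hc
    have hcw : c = w + a := by
      apply hA.add_right_cancel (w := p + a)
      calc c + (p + a) = (p + a) + c := add_comm _ _
        _ = (v + a) + (u + a) := h₂
        _ = (v + u) + (a + a) := add_add_add_comm _ _ _ _
        _ = (p + w) + (a + a) := by rw [h₁]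
        _ = (w + a) + (p + a) := by rw [add_comm p w, add_add_add_comm]
    exact hcw ▸ hc
  · obtain ⟨s, rfl⟩ := (hA.1 _ _).1 ha.1
    obtain ⟨t, rfl⟩ := (hA.1 _ _).1 hb.1
    apply O.le_antisymm
    · have h : O.le (u + s) (u + t) :=
        ha.2.2 _ ((hA.1 _ _).2 ⟨t, rfl⟩) (O.add_le_add _ _ _ hb.2.1)
      have h' := O.add_le_add _ _ b h
      rwa [add_assoc u t b, add_comm t b] at h'
    · have h := (htrans _ _ s _ hb).2.2 _ ((hA.1 _ _).2 ⟨s, rfl⟩) ha.2.1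
      have h' := O.add_le_add _ _ u h
      rwa [add_comm _ u, add_comm _ u, add_comm b s, ← add_assoc u s b] at h'
end

section
/- Let S be a commutative monoid with two compatible partial orders ≤ and ⪯ such that S is naturally ordered with respect to ≤ (u ≤ v iff v = u + w for some w ∈ S) and ⪯ satisfies the strong cancellation property (u ⪯ v iff u + w ⪯ v + w, for every w ∈ S). Then for u, v ∈ S the following are equivalent: (a) the mixed upper envelope u ⩖ v exists in S; (b) the set {w ∈ S : u ⪯ w + v} has a least element m with respect to ≤. Moreover, in that case m + v = u ⩖ v. -/
theorem TwoOrders.add_right_cancel_of_sle_cancel {M : Type*} [AddCommMonoid M]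
    (O : TwoOrders M) (hcanc : ∀ u v w : M, O.sle u v ↔ O.sle (u + w) (v + w))
    {a b c : M} (h : a + c = b + c) : a = b :=
  O.sle_antisymm a b ((hcanc a b c).2 (h ▸ O.sle_refl _)) ((hcanc b a c).2 (h ▸ O.sle_refl _))

theorem Bstructure_upper_env_char {M : Type*} [AddCommMonoid M]
    (O : TwoOrders M)
    (hnat : ∀ u v : M, O.le u v ↔ ∃ w, v = u + w)
    (hcanc : ∀ u v w : M, O.sle u v ↔ O.sle (u + w) (v + w))
    (u v : M) :
    ((∃ w, O.IsUpperEnv u v w) ↔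
      (∃ m, O.sle u (m + v) ∧ ∀ z, O.sle u (z + v) → O.le m z)) ∧
    (∀ m, (O.sle u (m + v) ∧ ∀ z, O.sle u (z + v) → O.le m z) →
      O.IsUpperEnv u v (m + v)) := by
  have env_of_least : ∀ m, (O.sle u (m + v) ∧ ∀ z, O.sle u (z + v) → O.le m z) →
      O.IsUpperEnv u v (m + v) := by
    rintro m ⟨hm, hmin⟩
    refine ⟨hm, (hnat _ _).2 ⟨m, add_comm m v⟩, fun z huz hvz => ?_⟩
    obtain ⟨t, rfl⟩ := (hnat _ _).1 hvz
    rw [add_comm v t] at huz ⊢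
    exact O.add_le_add _ _ _ (hmin t huz)
  refine ⟨⟨?_, fun ⟨m, hm⟩ => ⟨m + v, env_of_least m hm⟩⟩, env_of_least⟩
  rintro ⟨w, huw, hvw, hmin⟩
  obtain ⟨m, rfl⟩ := (hnat _ _).1 hvw
  refine ⟨m, add_comm v m ▸ huw, fun z hz => ?_⟩
  obtain ⟨t, ht⟩ := (hnat _ _).1 (hmin (z + v) hz ((hnat _ _).2 ⟨z, add_comm z v⟩))
  refine (hnat _ _).2 ⟨t, O.add_right_cancel_of_sle_cancel hcanc (c := v) ?_⟩
  rw [ht, add_assoc, add_comm]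
end

section
/- If S is a B-structure, then the translation invariance (u + a) ⩖ (v + a) = (u ⩖ v) + a holds for all u, v, a ∈ S. -/
theorem Bstructure_translation_invariance {M : Type*} [AddCommMonoid M]
    (O : TwoOrders M) (hB : O.IsBStructure) :
    ∀ u v a w : M, O.IsUpperEnv u v w → O.IsUpperEnv (u + a) (v + a) (w + a) := by
  obtain ⟨hle, hcancel, -⟩ := hB
  rintro u v a w ⟨huw, hvw, hmin⟩
  refine ⟨O.add_sle_add _ _ _ huw, O.add_le_add _ _ _ hvw, fun z huz hvz => ?_⟩
  obtain ⟨c, rfl⟩ := (hle _ _).1 hvz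
  rw [add_right_comm] at huz ⊢
  exact O.add_le_add _ _ _ (hmin _ ((hcancel _ _ _).2 huz) ((hle _ _).2 ⟨c, rfl⟩))
end

section
/- A B-structure S is a positive B-structure (i.e. 0 ⪯ x for all x ∈ S) if and only if the inequality u ⩖ v ≤ u + v holds for all u, v ∈ S. -/
theorem positive_Bstructure_iff {M : Type*} [AddCommMonoid M]
    (O : TwoOrders M) (hB : O.IsBStructure) :
    (∀ x : M, O.sle 0 x) ↔ (∀ u v w : M, O.IsUpperEnv u v w → O.le w (u + v)) := by
  obtain ⟨hnat, hcancel, henv⟩ := hB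
  constructor
  · intro h u v w hw
    refine hw.2.2 (u + v) ?_ ((hnat _ _).2 ⟨u, add_comm u v⟩)
    simpa [add_comm v u] using (hcancel 0 v u).1 (h v)
  · intro h x
    obtain ⟨w, hw⟩ := henv 0 x
    have hwx : O.le w x := by simpa using h 0 x w hw
    exact O.le_antisymm _ _ hwx hw.2.1 ▸ hw.1
end

section
/- Let S be a positive B-structure and u, v ∈ S. Then the following are equivalent: (a) the mixed lower envelope v ⩗ u exists in S; (b) the set {w ∈ S : u ⪯ w + v and w ≤ u} has a least element m with respect to ≤; (c) the set {w ∈ S : u ⩖ v + w ⪯ u + v and w ≤ u} has a greatest element M with respect to ≤. Moreover, the least element in (b) satisfies m + (v ⩗ u) = u, and the greatest element in (c) is M = v ⩗ u. -/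
namespace TwoOrders.IsBStructure

variable {M : Type*} [AddCommMonoid M] {O : TwoOrders M}

theorem add_right_cancel (hB : O.IsBStructure) {a b c : M} (h : a + c = b + c) : a = b :=
  O.sle_antisymm a b ((hB.2.1 a b c).2 (h ▸ O.sle_refl _)) ((hB.2.1 b a c).2 (h ▸ O.sle_refl _))

theorem sle_of_le (hB : O.IsBStructure) (hpos : ∀ x : M, O.sle 0 x) {a b : M}
    (h : O.le a b) : O.sle a b := by
  obtain ⟨w, rfl⟩ := (hB.1 a b).1 h
  simpa [add_comm] using O.add_sle_add 0 w a (hpos w)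

/-- The map `x ↦ u - x` on `{x | x ≤ u}` reverses the initial order. -/
theorem le_of_add_eq_add (hB : O.IsBStructure) {a b a' b' : M} (h : a + a' = b + b')
    (hab : O.le a b) : O.le b' a' := by
  obtain ⟨c, rfl⟩ := (hB.1 a b).1 hab
  refine (hB.1 b' a').2 ⟨c, hB.add_right_cancel (c := a) ?_⟩
  rw [add_comm a' a, h]
  abel

theorem sle_add_iff_of_add_eq (hB : O.IsBStructure) {u v a b : M} (h : a + b = u) :
    O.sle u (a + v) ↔ O.sle b v := by
  rw [hB.2.1 b v a, add_comm b, add_comm v, h]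

/-- If `m + w = u`, then `w` is the mixed lower envelope `v ⩗ u` if and only if `m` is the least
element of `{z | u ⪯ z + v ∧ z ≤ u}`. -/
theorem isLowerEnv_iff_of_add_eq (hB : O.IsBStructure) {u v m w : M} (h : m + w = u) :
    O.IsLowerEnv v u w ↔ (O.sle u (m + v) ∧ O.le m u) ∧
      ∀ z, (O.sle u (z + v) ∧ O.le z u) → O.le m z := by
  have hm : O.le m u := (hB.1 m u).2 ⟨w, h.symm⟩
  have hw : O.le w u := (hB.1 w u).2 ⟨m, by rw [← h, add_comm]⟩
  rw [hB.sle_add_iff_of_add_eq h]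
  constructor
  · rintro ⟨hwv, -, hmax⟩
    refine ⟨⟨hwv, hm⟩, fun z ⟨hz, hzu⟩ => ?_⟩
    obtain ⟨z', hz'⟩ := (hB.1 z u).1 hzu
    have hle := hmax z' ((hB.sle_add_iff_of_add_eq hz'.symm).1 hz)
      ((hB.1 z' u).2 ⟨z, by rw [hz', add_comm]⟩)
    exact hB.le_of_add_eq_add (by rw [add_comm z', ← hz', add_comm w, h]) hle
  · rintro ⟨⟨hwv, -⟩, hmin⟩
    refine ⟨hwv, hw, fun z hz hzu => ?_⟩
    obtain ⟨z', hz'⟩ := (hB.1 z u).1 hzu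
    have hz'' : z' + z = u := by rw [hz', add_comm]
    have hle := hmin z' ⟨(hB.sle_add_iff_of_add_eq hz'').2 hz, (hB.1 z' u).2 ⟨z, hz''.symm⟩⟩
    exact hB.le_of_add_eq_add (h.trans hz''.symm) hle

theorem upperEnv_add_sle_iff (hB : O.IsBStructure) (hpos : ∀ x : M, O.sle 0 x) {u v e z : M}
    (he : O.IsUpperEnv u v e) (hz : O.le z u) : O.sle (e + z) (u + v) ↔ O.sle z v := by
  constructor
  · intro h
    rw [hB.2.1 z v u, add_comm z, add_comm v]
    exact O.sle_trans _ _ _ (O.add_sle_add _ _ z he.1) h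
  · intro h
    obtain ⟨z', hz'⟩ := (hB.1 z u).1 hz
    have huz' : z' + z = u := by rw [hz', add_comm]
    have hle : O.le e (z' + v) := he.2.2 _ ((hB.sle_add_iff_of_add_eq huz').2 h)
      ((hB.1 _ _).2 ⟨z', add_comm _ _⟩)
    have hle' := O.add_le_add _ _ z hle
    rw [add_right_comm, huz'] at hle'
    exact hB.sle_of_le hpos hle'

end TwoOrders.IsBStructure

theorem positive_Bstructure_lower_env_char {M : Type*} [AddCommMonoid M]
    (O : TwoOrders M) (hB : O.IsBStructure) (hpos : ∀ x : M, O.sle 0 x)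
    (u v : M) :
    (((∃ w, O.IsLowerEnv v u w) ↔
        (∃ m, (O.sle u (m + v) ∧ O.le m u) ∧
          ∀ z, (O.sle u (z + v) ∧ O.le z u) → O.le m z)) ∧
      ((∃ w, O.IsLowerEnv v u w) ↔
        (∀ e, O.IsUpperEnv u v e →
          ∃ M', (O.sle (e + M') (u + v) ∧ O.le M' u) ∧
            ∀ z, (O.sle (e + z) (u + v) ∧ O.le z u) → O.le z M'))) ∧
    (∀ m w, ((O.sle u (m + v) ∧ O.le m u) ∧
        ∀ z, (O.sle u (z + v) ∧ O.le z u) → O.le m z) →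
      O.IsLowerEnv v u w → m + w = u) ∧
    (∀ e M', O.IsUpperEnv u v e →
      ((O.sle (e + M') (u + v) ∧ O.le M' u) ∧
        ∀ z, (O.sle (e + z) (u + v) ∧ O.le z u) → O.le z M') →
      O.IsLowerEnv v u M') := by
  have hset : ∀ e, O.IsUpperEnv u v e → ∀ z,
      (O.sle (e + z) (u + v) ∧ O.le z u) ↔ (O.sle z v ∧ O.le z u) := fun e he z =>
    and_congr_left fun hz => hB.upperEnv_add_sle_iff hpos he hz
  have hlower : ∀ e M', O.IsUpperEnv u v e →
      (O.IsLowerEnv v u M' ↔ (O.sle (e + M') (u + v) ∧ O.le M' u) ∧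
        ∀ z, (O.sle (e + z) (u + v) ∧ O.le z u) → O.le z M') := by
    intro e M' he
    simp only [hset e he, TwoOrders.IsLowerEnv, and_assoc, and_imp]
  have hleast : ∀ m w, m + w = u →
      (O.IsLowerEnv v u w ↔ (O.sle u (m + v) ∧ O.le m u) ∧
        ∀ z, (O.sle u (z + v) ∧ O.le z u) → O.le m z) :=
    fun m w h => hB.isLowerEnv_iff_of_add_eq h
  refine ⟨⟨⟨?_, ?_⟩, ⟨?_, ?_⟩⟩, ?_, fun e M' he h => (hlower e M' he).2 h⟩
  · rintro ⟨w, hw⟩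
    obtain ⟨m, hm⟩ := (hB.1 w u).1 hw.2.1
    exact ⟨m, (hleast m w (by rw [hm, add_comm])).1 hw⟩
  · rintro ⟨m, hm⟩
    obtain ⟨w, hw⟩ := (hB.1 m u).1 hm.1.2
    exact ⟨w, (hleast m w hw.symm).2 hm⟩
  · rintro ⟨w, hw⟩ e he
    exact ⟨w, (hlower e w he).1 hw⟩
  · intro h
    obtain ⟨e, he⟩ := hB.2.2 u v
    obtain ⟨w, hw⟩ := h e he
    exact ⟨w, (hlower e w he).2 hw⟩
  · intro m w hm hw
    obtain ⟨m', hm'⟩ := (hB.1 w u).1 hw.2.1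
    have h : m' + w = u := by rw [hm', add_comm]
    have hleast' := (hleast m' w h).1 hw
    rw [O.le_antisymm m m' (hm.2 m' hleast'.1) (hleast'.2 m hm.1), h]
end

section
/- Let G be a mixed lattice group and let S be an A-substructure of G. Then the subgroup E = {u − v : u, v ∈ S} generated by S is a mixed lattice subgroup of G; that is, for all x, y ∈ E, both x ⩖ y ∈ E and x ⩗ y ∈ E. -/
theorem TwoOrders.le_of_sub_eq_sub {G : Type*} [AddCommGroup G] (O : TwoOrders G)
    {x y a b : G} (h : O.le x y) (hab : b - a = y - x) : O.le a b := by
  have h' := O.add_le_add x y (a - x) h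
  have hb : y + (a - x) = b := by rw [← add_sub_assoc, add_sub_right_comm, ← hab, sub_add_cancel]
  rwa [add_sub_cancel, hb] at h'

theorem TwoOrders.sle_of_sub_eq_sub {G : Type*} [AddCommGroup G] (O : TwoOrders G)
    {x y a b : G} (h : O.sle x y) (hab : b - a = y - x) : O.sle a b := by
  have h' := O.add_sle_add x y (a - x) h
  have hb : y + (a - x) = b := by rw [← add_sub_assoc, add_sub_right_comm, ← hab, sub_add_cancel]
  rwa [add_sub_cancel, hb] at h'

/-- Mixed upper envelopes are translation invariant. -/
theorem TwoOrders.IsUpperEnv.add_right {G : Type*} [AddCommGroup G] {O : TwoOrders G}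
    {x y w : G} (h : O.IsUpperEnv x y w) (t : G) : O.IsUpperEnv (x + t) (y + t) (w + t) := by
  obtain ⟨hx, hy, hmin⟩ := h
  refine ⟨O.add_sle_add _ _ _ hx, O.add_le_add _ _ _ hy, fun z hxz hyz => ?_⟩
  have hz := hmin (z - t) (O.sle_of_sub_eq_sub hxz (by abel)) (O.le_of_sub_eq_sub hyz (by abel))
  exact O.le_of_sub_eq_sub hz (by abel)

/-- The identity `x ⩗ y + y ⩖ x = x + y`. -/
theorem TwoOrders.IsLowerEnv.isUpperEnv_swap {G : Type*} [AddCommGroup G] {O : TwoOrders G}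
    {x y w : G} (h : O.IsLowerEnv x y w) : O.IsUpperEnv y x (x + y - w) := by
  obtain ⟨hx, hy, hmax⟩ := h
  refine ⟨O.sle_of_sub_eq_sub hx (by abel), O.le_of_sub_eq_sub hy (by abel), fun z hyz hxz => ?_⟩
  have hz := hmax (x + y - z) (O.sle_of_sub_eq_sub hyz (by abel))
    (O.le_of_sub_eq_sub hxz (by abel))
  exact O.le_of_sub_eq_sub hz (by abel)

theorem Asubstructure_generates_ml_subgroup {G : Type*} [AddCommGroup G]
    (O : TwoOrders G) (hMLG : O.IsMLG)
    (S : Set G) (h0 : (0 : G) ∈ S) (hadd : ∀ x ∈ S, ∀ y ∈ S, x + y ∈ S)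
    (hsp : ∀ x ∈ S, O.sle 0 x)
    (hA : ∀ x ∈ S, ∀ y ∈ S, ∀ e, O.IsUpperEnv x y e → e - x ∈ S)
    (E : Set G) (hE : E = {x | ∃ u ∈ S, ∃ v ∈ S, x = u - v}) :
    ((0 : G) ∈ E ∧ (∀ x ∈ E, ∀ y ∈ E, x + y ∈ E) ∧ (∀ x ∈ E, -x ∈ E)) ∧
    (∀ x ∈ E, ∀ y ∈ E, ∀ w, O.IsUpperEnv x y w → w ∈ E) ∧
    (∀ x ∈ E, ∀ y ∈ E, ∀ w, O.IsLowerEnv x y w → w ∈ E) := by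
  subst hE
  have add_mem : ∀ x ∈ {x | ∃ u ∈ S, ∃ v ∈ S, x = u - v},
      ∀ y ∈ {x | ∃ u ∈ S, ∃ v ∈ S, x = u - v}, x + y ∈ {x | ∃ u ∈ S, ∃ v ∈ S, x = u - v} := by
    rintro _ ⟨a, ha, b, hb, rfl⟩ _ ⟨c, hc, d, hd, rfl⟩
    exact ⟨a + c, hadd a ha c hc, b + d, hadd b hb d hd, by abel⟩
  have neg_mem : ∀ x ∈ {x | ∃ u ∈ S, ∃ v ∈ S, x = u - v},
      -x ∈ {x | ∃ u ∈ S, ∃ v ∈ S, x = u - v} := by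
    rintro _ ⟨a, ha, b, hb, rfl⟩
    exact ⟨b, hb, a, ha, by abel⟩
  have upper_mem : ∀ x ∈ {x | ∃ u ∈ S, ∃ v ∈ S, x = u - v},
      ∀ y ∈ {x | ∃ u ∈ S, ∃ v ∈ S, x = u - v}, ∀ w, O.IsUpperEnv x y w →
        w ∈ {x | ∃ u ∈ S, ∃ v ∈ S, x = u - v} := by
    rintro _ ⟨a, ha, b, hb, rfl⟩ _ ⟨c, hc, d, hd, rfl⟩ w hw
    have hw' := hw.add_right (b + d)
    rw [show a - b + (b + d) = a + d by abel, show c - d + (b + d) = c + b by abel] at hw'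
    have hs := hA _ (hadd a ha d hd) _ (hadd c hc b hb) _ hw'
    exact ⟨_, hadd _ hs a ha, b, hb, by abel⟩
  refine ⟨⟨⟨0, h0, 0, h0, by simp⟩, add_mem, neg_mem⟩, upper_mem, fun x hx y hy w hw => ?_⟩
  have hu := upper_mem y hy x hx _ hw.isUpperEnv_swap
  rw [show w = x + y + -(x + y - w) by abel]
  exact add_mem _ (add_mem x hx y hy) _ (neg_mem _ hu)
end

section
/- Let G be a mixed lattice group. Then G is quasi-regular (i.e. x ⩗ y ⪰ 0 whenever x ⪰ 0 and y ⪰ 0) if and only if for all u, x, y, z ∈ G: u ⪯ x ⪯ z and u ⪯ y ⪯ z together imply x ⩖ y ⪯ z and u ⪯ x ⩗ y. -/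
namespace TwoOrders

variable {G : Type*} [AddCommGroup G] (O : TwoOrders G)

theorem le_of_sub_eq_sub_s13 {a b c d : G} (h : O.le a b) (hd : b - a = d - c) : O.le c d := by
  have key := O.add_le_add a b (c - a) h
  rwa [show a + (c - a) = c by abel, show b + (c - a) = b - a + c by abel, hd,
    sub_add_cancel] at key

theorem sle_of_sub_eq_sub_s13 {a b c d : G} (h : O.sle a b) (hd : b - a = d - c) : O.sle c d := by
  have key := O.add_sle_add a b (c - a) h
  rwa [show a + (c - a) = c by abel, show b + (c - a) = b - a + c by abel, hd,
    sub_add_cancel] at key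

variable {O}

theorem IsLowerEnv.sub_right {x y b : G} (h : O.IsLowerEnv x y b) (u : G) :
    O.IsLowerEnv (x - u) (y - u) (b - u) := by
  refine ⟨O.sle_of_sub_eq_sub_s13 h.1 (by abel), O.le_of_sub_eq_sub_s13 h.2.1 (by abel), ?_⟩
  intro t htx hty
  exact O.le_of_sub_eq_sub_s13 (h.2.2 (t + u) (O.sle_of_sub_eq_sub_s13 htx (by abel))
    (O.le_of_sub_eq_sub_s13 hty (by abel))) (by abel)

theorem IsUpperEnv.sub_left {x y a : G} (h : O.IsUpperEnv x y a) (z : G) :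
    O.IsLowerEnv (z - x) (z - y) (z - a) := by
  refine ⟨O.sle_of_sub_eq_sub_s13 h.1 (by abel), O.le_of_sub_eq_sub_s13 h.2.1 (by abel), ?_⟩
  intro t htx hty
  exact O.le_of_sub_eq_sub_s13 (h.2.2 (z - t) (O.sle_of_sub_eq_sub_s13 htx (by abel))
    (O.le_of_sub_eq_sub_s13 hty (by abel))) (by abel)

end TwoOrders

theorem quasi_regular_characterization {G : Type*} [AddCommGroup G]
    (O : TwoOrders G) (hMLG : O.IsMLG) :
    (∀ x y w : G, O.sle 0 x → O.sle 0 y → O.IsLowerEnv x y w → O.sle 0 w) ↔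
    (∀ u x y z a b : G, O.sle u x → O.sle x z → O.sle u y → O.sle y z →
      O.IsUpperEnv x y a → O.IsLowerEnv x y b → O.sle a z ∧ O.sle u b) := by
  constructor
  · intro hq u x y z a b hux hxz huy hyz ha hb
    constructor
    · exact O.sle_of_sub_eq_sub_s13
        (hq _ _ _ (O.sle_of_sub_eq_sub_s13 hxz (by abel)) (O.sle_of_sub_eq_sub_s13 hyz (by abel))
          (ha.sub_left z)) (by abel)
    · exact O.sle_of_sub_eq_sub_s13
        (hq _ _ _ (O.sle_of_sub_eq_sub_s13 hux (by abel)) (O.sle_of_sub_eq_sub_s13 huy (by abel))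
          (hb.sub_right u)) (by abel)
  · intro h x y w hx hy hw
    obtain ⟨a, ha⟩ := hMLG.1 x y
    exact (h 0 x y (x + y) a w hx (O.sle_of_sub_eq_sub_s13 hy (by abel)) hy
      (O.sle_of_sub_eq_sub_s13 hx (by abel)) ha hw).2
end

section
/- Let G be a quasi-regular mixed lattice group. Then for all x, y, z ∈ G, x ⪯ y implies z ⩗ x ⪯ z ⩗ y and z ⩖ x ⪯ z ⩖ y; that is, the mixed envelopes are monotone in their second argument with respect to the specific order ⪯. -/
namespace TwoOrders

variable {G : Type*} [AddCommGroup G] (O : TwoOrders G)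

theorem le_of_sub_eq_sub_s14 {u v u' v' : G} (h : O.le u v) (e : v - u = v' - u') : O.le u' v' := by
  have := O.add_le_add u v (u' - u) h
  rwa [add_sub_cancel, show v + (u' - u) = (v - u) + u' by abel, e, sub_add_cancel] at this

theorem sle_of_sub_eq_sub_s14 {u v u' v' : G} (h : O.sle u v) (e : v - u = v' - u') :
    O.sle u' v' := by
  have := O.add_sle_add u v (u' - u) h
  rwa [add_sub_cancel, show v + (u' - u) = (v - u) + u' by abel, e, sub_add_cancel] at this

variable {O}

theorem IsLowerEnv.neg {u v w : G} (h : O.IsLowerEnv u v w) : O.IsUpperEnv (-u) (-v) (-w) :=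
  ⟨O.sle_of_sub_eq_sub_s14 h.1 (by abel), O.le_of_sub_eq_sub_s14 h.2.1 (by abel), fun t hu hv =>
    O.le_of_sub_eq_sub_s14 (h.2.2 (-t) (O.sle_of_sub_eq_sub_s14 hu (by abel))
      (O.le_of_sub_eq_sub_s14 hv (by abel))) (by abel)⟩

/-- In a quasi-regular mixed lattice group the upper envelope is monotone in its second argument
with respect to the specific order. -/
theorem IsUpperEnv.sle_of_sle (hMLG : O.IsMLG)
    (hqr : ∀ x y w : G, O.sle 0 x → O.sle 0 y → O.IsLowerEnv x y w → O.sle 0 w)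
    {x y z c d : G} (hxy : O.sle x y) (hc : O.IsUpperEnv z x c) (hd : O.IsUpperEnv z y d) :
    O.sle c d := by
  obtain ⟨r, hr⟩ := hMLG.2 (d - z) (c - z)
  have hr0 : O.sle 0 r := hqr _ _ _ (O.sle_of_sub_eq_sub_s14 hd.1 (by abel))
    (O.sle_of_sub_eq_sub_s14 hc.1 (by abel)) hr
  have hdc : O.le d (c + (y - x)) :=
    hd.2.2 _ (O.sle_trans _ _ _ hc.1 (O.sle_of_sub_eq_sub_s14 hxy (by abel)))
      (O.le_of_sub_eq_sub_s14 hc.2.1 (by abel))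
  have hle : O.le (d - (y - x) - z) r :=
    hr.2.2 _ (O.sle_of_sub_eq_sub_s14 hxy (by abel)) (O.le_of_sub_eq_sub_s14 hdc (by abel))
  have hxr : O.le x (r + z) :=
    O.le_trans _ (d - (y - x)) _ (O.le_of_sub_eq_sub_s14 hd.2.1 (by abel))
      (O.le_of_sub_eq_sub_s14 hle (by abel))
  have hcr : c = r + z := O.le_antisymm _ _
    (hc.2.2 _ (O.sle_of_sub_eq_sub_s14 hr0 (by abel)) hxr) (O.le_of_sub_eq_sub_s14 hr.2.1 (by abel))
  rw [hcr]
  exact O.sle_of_sub_eq_sub_s14 hr.1 (by abel)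

end TwoOrders

theorem quasi_regular_monotone {G : Type*} [AddCommGroup G]
    (O : TwoOrders G) (hMLG : O.IsMLG)
    (hqr : ∀ x y w : G, O.sle 0 x → O.sle 0 y → O.IsLowerEnv x y w → O.sle 0 w) :
    ∀ x y z a b c d : G, O.sle x y →
      O.IsLowerEnv z x a → O.IsLowerEnv z y b →
      O.IsUpperEnv z x c → O.IsUpperEnv z y d →
      O.sle a b ∧ O.sle c d := by
  intro x y z a b c d hxy ha hb hc hd
  refine ⟨?_, hc.sle_of_sle hMLG hqr hxy hd⟩
  have hneg : O.sle (-b) (-a) :=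
    hb.neg.sle_of_sle hMLG hqr (O.sle_of_sub_eq_sub_s14 hxy (by abel)) ha.neg
  exact O.sle_of_sub_eq_sub_s14 hneg (by abel)
end

section
/- Let G be a mixed lattice group and let F = {x ∈ G : 0 ⪯ x and 0 ≤ x}. Then the set E = {u − v : u, v ∈ F} of regular elements is a mixed lattice subgroup of G; that is, E is a subgroup of G and for all x, y ∈ E, both x ⩖ y ∈ E and x ⩗ y ∈ E. -/
namespace TwoOrders

variable {G : Type*} [AddCommGroup G] (O : TwoOrders G)

theorem sle_zero_add {a b : G} (ha : O.sle 0 a) (hb : O.sle 0 b) : O.sle 0 (a + b) :=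
  O.sle_trans _ _ _ hb (by simpa using O.add_sle_add 0 a b ha)

theorem le_zero_add {a b : G} (ha : O.le 0 a) (hb : O.le 0 b) : O.le 0 (a + b) :=
  O.le_trans _ _ _ hb (by simpa using O.add_le_add 0 a b ha)

/-- The subgroup of regular elements: differences of elements that are nonnegative for both
orders. -/
def regularSubgroup : AddSubgroup G where
  carrier := {x | ∃ u ∈ {x | O.sle 0 x ∧ O.le 0 x}, ∃ v ∈ {x | O.sle 0 x ∧ O.le 0 x}, x = u - v}
  zero_mem' := ⟨0, ⟨O.sle_refl 0, O.le_refl 0⟩, 0, ⟨O.sle_refl 0, O.le_refl 0⟩, by simp⟩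
  add_mem' := by
    rintro _ _ ⟨a, ha, b, hb, rfl⟩ ⟨c, hc, d, hd, rfl⟩
    exact ⟨a + c, ⟨O.sle_zero_add ha.1 hc.1, O.le_zero_add ha.2 hc.2⟩,
      b + d, ⟨O.sle_zero_add hb.1 hd.1, O.le_zero_add hb.2 hd.2⟩, by abel⟩
  neg_mem' := by
    rintro _ ⟨a, ha, b, hb, rfl⟩
    exact ⟨b, hb, a, ha, by abel⟩

/-- An element lying above one regular element for the specific order and above another one for
the initial order is regular. -/
theorem mem_regularSubgroup_of_sle_of_le {x y w : G} (hx : x ∈ O.regularSubgroup)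
    (hy : y ∈ O.regularSubgroup) (hxw : O.sle x w) (hyw : O.le y w) :
    w ∈ O.regularSubgroup := by
  obtain ⟨a, ha, b, hb, rfl⟩ := hx
  obtain ⟨c, hc, d, hd, rfl⟩ := hy
  refine ⟨w + (b + d), ⟨?_, ?_⟩, b + d,
    ⟨O.sle_zero_add hb.1 hd.1, O.le_zero_add hb.2 hd.2⟩, by abel⟩
  · have h := O.add_sle_add _ _ (b + d) hxw
    rw [show a - b + (b + d) = a + d by abel] at h
    exact O.sle_trans _ _ _ (O.sle_zero_add ha.1 hd.1) h
  · have h := O.add_le_add _ _ (b + d) hyw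
    rw [show c - d + (b + d) = c + b by abel] at h
    exact O.le_trans _ _ _ (O.le_zero_add hc.2 hb.2) h

end TwoOrders

theorem regular_elements_ml_subgroup {G : Type*} [AddCommGroup G]
    (O : TwoOrders G) (hMLG : O.IsMLG)
    (F E : Set G) (hF : F = {x | O.sle 0 x ∧ O.le 0 x})
    (hE : E = {x | ∃ u ∈ F, ∃ v ∈ F, x = u - v}) :
    ((0 : G) ∈ E ∧ (∀ x ∈ E, ∀ y ∈ E, x + y ∈ E) ∧ (∀ x ∈ E, -x ∈ E)) ∧
    (∀ x ∈ E, ∀ y ∈ E, ∀ w, O.IsUpperEnv x y w → w ∈ E) ∧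
    (∀ x ∈ E, ∀ y ∈ E, ∀ w, O.IsLowerEnv x y w → w ∈ E) := by
  subst hF hE
  change (0 ∈ O.regularSubgroup ∧ (∀ x ∈ O.regularSubgroup, ∀ y ∈ O.regularSubgroup,
    x + y ∈ O.regularSubgroup) ∧ ∀ x ∈ O.regularSubgroup, -x ∈ O.regularSubgroup) ∧
    (∀ x ∈ O.regularSubgroup, ∀ y ∈ O.regularSubgroup, ∀ w, O.IsUpperEnv x y w →
      w ∈ O.regularSubgroup) ∧
    (∀ x ∈ O.regularSubgroup, ∀ y ∈ O.regularSubgroup, ∀ w, O.IsLowerEnv x y w →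
      w ∈ O.regularSubgroup)
  refine ⟨⟨zero_mem _, fun x hx y hy => add_mem hx hy, fun x hx => neg_mem hx⟩,
    fun x hx y hy w hw => O.mem_regularSubgroup_of_sle_of_le hx hy hw.1 hw.2.1,
    fun x hx y hy w hw => ?_⟩
  have hneg : -w ∈ O.regularSubgroup := by
    refine O.mem_regularSubgroup_of_sle_of_le (neg_mem hx) (neg_mem hy) ?_ ?_
    · have h := O.add_sle_add _ _ (-w - x) hw.1
      rwa [show w + (-w - x) = -x by abel, show x + (-w - x) = -w by abel] at h
    · have h := O.add_le_add _ _ (-w - y) hw.2.1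
      rwa [show w + (-w - y) = -y by abel, show y + (-w - y) = -w by abel] at h
  exact neg_mem_iff.mp hneg
end

section
/- Let G be a mixed lattice group such that either (a) {x : 0 ⪯ x} ⊆ {x : 0 ≤ x} and G is (≤)-Archimedean, or (b) {x : 0 ≤ x} ⊆ {x : 0 ⪯ x} and G is (⪯)-Archimedean. Then every nonzero element of G has infinite order; that is, if k • x = 0 for some positive natural number k, then x = 0. -/
/-- In an abelian group with a directed Archimedean translation-invariant partial order `r`,
every element of finite order is zero. -/
theorem eq_zero_of_nsmul_eq_zero_of_directed {G : Type*} [AddCommGroup G] (r : G → G → Prop)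
    (antisymm : ∀ x y, r x y → r y x → x = y)
    (trans : ∀ x y z, r x y → r y z → r x z)
    (add_right : ∀ x y w, r x y → r (x + w) (y + w))
    (directed : ∀ u v, ∃ w, r u w ∧ r v w)
    (arch : ∀ x y : G, (∀ n : ℕ, 0 < n → r (n • x) y) → r x 0)
    {x : G} {k : ℕ} (hk : 0 < k) (hx : k • x = 0) : x = 0 := by
  have bound (z : G) (m : ℕ) : ∃ y, ∀ i < m, r (i • z) y := by
    induction m with
    | zero => exact ⟨0, fun i hi => absurd hi i.not_lt_zero⟩
    | succ m ih =>
      obtain ⟨y, hy⟩ := ih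
      obtain ⟨w, hyw, hmw⟩ := directed y (m • z)
      refine ⟨w, fun i hi => ?_⟩
      rcases Nat.lt_succ_iff_lt_or_eq.mp hi with h | rfl
      · exact trans _ _ _ (hy i h) hyw
      · exact hmw
  have nonpos (z : G) (hz : k • z = 0) : r z 0 := by
    obtain ⟨y, hy⟩ := bound z k
    refine arch z y fun n _ => ?_
    rw [← Nat.mod_add_div n k, add_nsmul, mul_comm, mul_nsmul', hz, nsmul_zero, add_zero]
    exact hy _ (Nat.mod_lt n hk)
  refine antisymm x 0 (nonpos x hx) ?_
  simpa using add_right _ _ x (nonpos (-x) (by rw [smul_neg, hx, neg_zero]))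

/-- Inclusion of positive cones gives inclusion of the translation-invariant orders. -/
theorem rel_of_rel_of_cone_subset {G : Type*} [AddCommGroup G] {r s : G → G → Prop}
    (hr : ∀ x y w, r x y → r (x + w) (y + w)) (hs : ∀ x y w, s x y → s (x + w) (y + w))
    (hcone : ∀ x, r 0 x → s 0 x) {u v : G} (huv : r u v) : s u v := by
  have h : r 0 (v - u) := by simpa [sub_eq_add_neg] using hr u v (-u) huv
  simpa using hs _ _ u (hcone _ h)

theorem archimedean_infinite_order {G : Type*} [AddCommGroup G]
    (O : TwoOrders G) (hMLG : O.IsMLG)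
    (h : ((∀ x : G, O.sle 0 x → O.le 0 x) ∧
            (∀ x y : G, (∀ n : ℕ, 0 < n → O.le (n • x) y) → O.le x 0)) ∨
         ((∀ x : G, O.le 0 x → O.sle 0 x) ∧
            (∀ x y : G, (∀ n : ℕ, 0 < n → O.sle (n • x) y) → O.sle x 0))) :
    ∀ (x : G) (k : ℕ), 0 < k → k • x = 0 → x = 0 := by
  intro x k hk hx
  rcases h with ⟨hcone, arch⟩ | ⟨hcone, arch⟩
  · refine eq_zero_of_nsmul_eq_zero_of_directed O.le O.le_antisymm O.le_trans O.add_le_add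
      (fun u v => ?_) arch hk hx
    obtain ⟨w, huw, hvw, -⟩ := hMLG.1 u v
    exact ⟨w, rel_of_rel_of_cone_subset O.add_sle_add O.add_le_add hcone huw, hvw⟩
  · refine eq_zero_of_nsmul_eq_zero_of_directed O.sle O.sle_antisymm O.sle_trans O.add_sle_add
      (fun u v => ?_) arch hk hx
    obtain ⟨w, huw, hvw, -⟩ := hMLG.1 u v
    exact ⟨w, huw, rel_of_rel_of_cone_subset O.add_le_add O.add_sle_add hcone hvw⟩
end

section
/- Let G be a mixed lattice group that is (≤)-Archimedean or (⪯)-Archimedean, and let x ∈ G be a nonzero element of finite order (x ≠ 0 and k • x = 0 for some positive natural number k). Then x is not a regular element; that is, x cannot be written as x = u − v with u, v ∈ G satisfying 0 ⪯ u, 0 ≤ u, 0 ⪯ v and 0 ≤ v. -/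
/-- For a translation-invariant Archimedean partial order on a commutative group, a difference
of two nonnegative elements that has finite order is nonpositive. -/
theorem rel_zero_of_nsmul_sub_eq_zero {G : Type*} [AddCommGroup G] (r : G → G → Prop)
    (hrefl : ∀ a, r a a) (htrans : ∀ a b c, r a b → r b c → r a c)
    (hadd : ∀ a b c, r a b → r (a + c) (b + c))
    (hArch : ∀ x y : G, (∀ n : ℕ, 0 < n → r (n • x) y) → r x 0)
    {u v : G} (hu : r 0 u) (hv : r 0 v) {k : ℕ} (hk : 0 < k) (h : k • (u - v) = 0) :
    r (u - v) 0 := by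
  have nsmul_nonneg' : ∀ (a : G), r 0 a → ∀ n : ℕ, r 0 (n • a) := by
    intro a ha n
    induction n with
    | zero => simpa using hrefl 0
    | succ n ih =>
      refine htrans _ _ _ ha ?_
      simpa [succ_nsmul] using hadd _ _ a ih
  refine hArch _ (k • u) fun n _ => ?_
  have hmod : n • (u - v) = (n % k) • (u - v) := by
    conv_lhs => rw [← Nat.mod_add_div n k, add_nsmul, mul_comm, mul_nsmul', h]
    simp
  have hle : n % k ≤ k := (Nat.mod_lt n hk).le
  rw [hmod]
  refine htrans _ ((n % k) • u) _ ?_ ?_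
  · have := hadd _ _ ((n % k) • (u - v)) (nsmul_nonneg' v hv (n % k))
    simpa [nsmul_sub] using this
  · have := hadd _ _ ((n % k) • u) (nsmul_nonneg' u hu (k - n % k))
    rwa [zero_add, ← add_nsmul, Nat.sub_add_cancel hle] at this

/-- For a translation-invariant Archimedean partial order on a commutative group, a difference
of two nonnegative elements that has finite order vanishes. -/
theorem sub_eq_zero_of_nsmul_sub_eq_zero {G : Type*} [AddCommGroup G] (r : G → G → Prop)
    (hrefl : ∀ a, r a a) (hanti : ∀ a b, r a b → r b a → a = b)
    (htrans : ∀ a b c, r a b → r b c → r a c)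
    (hadd : ∀ a b c, r a b → r (a + c) (b + c))
    (hArch : ∀ x y : G, (∀ n : ℕ, 0 < n → r (n • x) y) → r x 0)
    {u v : G} (hu : r 0 u) (hv : r 0 v) {k : ℕ} (hk : 0 < k) (h : k • (u - v) = 0) :
    u - v = 0 := by
  have h' : k • (v - u) = 0 := by rw [← neg_sub, smul_neg, h, neg_zero]
  refine hanti _ _ (rel_zero_of_nsmul_sub_eq_zero r hrefl htrans hadd hArch hu hv hk h) ?_
  simpa using hadd _ _ (u - v)
    (rel_zero_of_nsmul_sub_eq_zero r hrefl htrans hadd hArch hv hu hk h')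

theorem finite_order_not_regular {G : Type*} [AddCommGroup G]
    (O : TwoOrders G) (hMLG : O.IsMLG)
    (hArch : (∀ x y : G, (∀ n : ℕ, 0 < n → O.le (n • x) y) → O.le x 0) ∨
             (∀ x y : G, (∀ n : ℕ, 0 < n → O.sle (n • x) y) → O.sle x 0))
    (x : G) (hx : x ≠ 0) (k : ℕ) (hk : 0 < k) (hkx : k • x = 0) :
    ¬ ∃ u v : G, O.sle 0 u ∧ O.le 0 u ∧ O.sle 0 v ∧ O.le 0 v ∧ x = u - v := by
  rintro ⟨u, v, hsu, hu, hsv, hv, rfl⟩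
  refine hx ?_
  rcases hArch with hA | hA
  · exact sub_eq_zero_of_nsmul_sub_eq_zero O.le O.le_refl O.le_antisymm O.le_trans
      O.add_le_add hA hu hv hk hkx
  · exact sub_eq_zero_of_nsmul_sub_eq_zero O.sle O.sle_refl O.sle_antisymm O.sle_trans
      O.add_sle_add hA hsu hsv hk hkx
end
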